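/- arXiv:2603.23230 — 6 statements merged into one kernel-verified Lean document; each statement's English description precedes it below -/
import Mathlib

section
/- Let F_q be a finite field with q elements, and let A₁, A₂, B₁, B₂ ∈ F_q^{k'×n} be matrices such that A₁·A₂ᵀ is invertible, and such that B₁ = S₁·A₁·Dⁱ·P and B₂ = S₂·A₂·Dʲ·P for some S₁, S₂ ∈ GL_{k'}(F_q), some diagonal matrix D with all diagonal entries in F_q^⋆, some permutation matrix P, and nonnegative integers i, j with (q−1) ∣ (i+j). Then B₁·B₂ᵀ is invertible and the multiset of diagonal entries of Adj(B₁,B₂) equals the multiset of diagonal entries of Adj(A₁,A₂). (This is the absence of false negatives in the paper's simple LEP solver, Proposition 2.) -/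
open Matrix

lemma Matrix.transpose_mul_inv_mul_units_mul {R m n : Type*} [CommRing R] [Fintype m]
    [DecidableEq m] [Fintype n] (A₁ A₂ : Matrix m n R) (S₁ S₂ : GL m R) :
    ((S₂ : Matrix m m R) * A₂)ᵀ * (((S₁ : Matrix m m R) * A₁) * ((S₂ : Matrix m m R) * A₂)ᵀ)⁻¹ *
      ((S₁ : Matrix m m R) * A₁) = A₂ᵀ * (A₁ * A₂ᵀ)⁻¹ * A₁ := by
  have h₁ : IsUnit (S₁ : Matrix m m R).det := (isUnit_iff_isUnit_det _).mp S₁.isUnit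
  have h₂ : IsUnit (S₂ : Matrix m m R)ᵀ.det := by
    rw [det_transpose]
    exact (isUnit_iff_isUnit_det _).mp S₂.isUnit
  have h : ((S₁ : Matrix m m R) * A₁) * ((S₂ : Matrix m m R) * A₂)ᵀ =
      (S₁ : Matrix m m R) * ((A₁ * A₂ᵀ) * (S₂ : Matrix m m R)ᵀ) := by
    simp only [transpose_mul, Matrix.mul_assoc]
  rw [h, mul_inv_rev, mul_inv_rev, transpose_mul]
  simp only [Matrix.mul_assoc]
  rw [nonsing_inv_mul_cancel_left _ _ h₁, mul_nonsing_inv_cancel_left _ _ h₂]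

/-- Proposition 2, no false negatives: over the finite field `F` with
`q` elements, if `A₁ * A₂ᵀ` is invertible and `B₁ = S₁ A₁ Dⁱ P`, `B₂ = S₂ A₂ Dʲ P`
for invertible `S₁, S₂`, a diagonal matrix `D` with nonzero diagonal entries, a
permutation matrix `P` and `(q-1) ∣ (i+j)`, then `B₁ * B₂ᵀ` is invertible and the
multiset of diagonal entries of `Adj(B₁,B₂) = B₂ᵀ (B₁ B₂ᵀ)⁻¹ B₁` equals the multiset
of diagonal entries of `Adj(A₁,A₂) = A₂ᵀ (A₁ A₂ᵀ)⁻¹ A₁`. -/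
theorem no_false_negatives {F : Type*} [Field F] [Fintype F] {k' n q : ℕ}
    (hq : Fintype.card F = q)
    (A₁ A₂ B₁ B₂ : Matrix (Fin k') (Fin n) F)
    (hA : IsUnit (A₁ * A₂ᵀ))
    (S₁ S₂ : GL (Fin k') F)
    (d : Fin n → F) (hd : ∀ u, d u ≠ 0)
    (σ : Equiv.Perm (Fin n))
    (i j : ℕ) (hij : (q - 1) ∣ (i + j))
    (hB₁ : B₁ = (S₁ : Matrix (Fin k') (Fin k') F) * A₁ * (Matrix.diagonal d) ^ i *
      σ.permMatrix F)
    (hB₂ : B₂ = (S₂ : Matrix (Fin k') (Fin k') F) * A₂ * (Matrix.diagonal d) ^ j *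
      σ.permMatrix F) :
    IsUnit (B₁ * B₂ᵀ) ∧
    Finset.univ.val.map (fun u : Fin n => (B₂ᵀ * (B₁ * B₂ᵀ)⁻¹ * B₁) u u)
      = Finset.univ.val.map (fun u : Fin n => (A₂ᵀ * (A₁ * A₂ᵀ)⁻¹ * A₁) u u) := by
  have hpow : ∀ u, d u ^ j * d u ^ i = 1 := fun u => by
    obtain ⟨c, hc⟩ := hij
    rw [← pow_add, add_comm, hc, pow_mul, ← hq, FiniteField.pow_card_sub_one_eq_one _ (hd u),
      one_pow]
  have hP : σ.permMatrix F * (σ.permMatrix F)ᵀ = 1 := by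
    rw [Matrix.transpose_permMatrix, ← Matrix.permMatrix_mul, inv_mul_cancel,
      Matrix.permMatrix_one]
  have hD : (diagonal d) ^ i * ((diagonal d) ^ j)ᵀ = (1 : Matrix (Fin n) (Fin n) F) := by
    rw [diagonal_pow, diagonal_pow, diagonal_transpose, diagonal_mul_diagonal, ← diagonal_one]
    congr 1
    funext u
    simpa [mul_comm] using hpow u
  have hB : B₁ * B₂ᵀ = ((S₁ : Matrix (Fin k') (Fin k') F) * A₁) *
      ((S₂ : Matrix (Fin k') (Fin k') F) * A₂)ᵀ := by
    subst hB₁ hB₂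
    generalize (S₁ : Matrix (Fin k') (Fin k') F) * A₁ = C₁
    generalize (S₂ : Matrix (Fin k') (Fin k') F) * A₂ = C₂
    calc _ = C₁ * ((diagonal d) ^ i * (σ.permMatrix F * (σ.permMatrix F)ᵀ) *
          ((diagonal d) ^ j)ᵀ) * C₂ᵀ := by
            simp only [transpose_mul, Matrix.mul_assoc]
      _ = C₁ * C₂ᵀ := by rw [hP, Matrix.mul_one, hD, Matrix.mul_one]
  constructor
  · have hS₂ : IsUnit (S₂ : Matrix (Fin k') (Fin k') F)ᵀ :=
      (isUnit_transpose _).mpr S₂.isUnit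
    have h := (S₁.isUnit.mul hA).mul hS₂
    rw [hB]
    simpa only [transpose_mul, Matrix.mul_assoc] using h
  · have hdiag : ∀ u, (B₂ᵀ * (B₁ * B₂ᵀ)⁻¹ * B₁) u u =
        (A₂ᵀ * (A₁ * A₂ᵀ)⁻¹ * A₁) (σ.symm u) (σ.symm u) := fun u => by
      rw [hB, ← Matrix.transpose_mul_inv_mul_units_mul A₁ A₂ S₁ S₂, hB₁, hB₂]
      generalize (S₁ : Matrix (Fin k') (Fin k') F) * A₁ = C₁
      generalize (S₂ : Matrix (Fin k') (Fin k') F) * A₂ = C₂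
      have h : (C₂ * diagonal d ^ j * σ.permMatrix F)ᵀ * (C₁ * C₂ᵀ)⁻¹ *
          (C₁ * diagonal d ^ i * σ.permMatrix F) =
          (diagonal (d ^ j) * (C₂ᵀ * (C₁ * C₂ᵀ)⁻¹ * C₁) * diagonal (d ^ i)).submatrix
            σ.symm σ.symm := by
        rw [PEquiv.mul_toMatrix_toPEquiv, PEquiv.mul_toMatrix_toPEquiv, transpose_submatrix]
        change ((C₂ * diagonal d ^ j)ᵀ * (C₁ * C₂ᵀ)⁻¹ * (C₁ * diagonal d ^ i)).submatrix _ _ = _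
        simp only [transpose_mul, diagonal_pow, diagonal_transpose, Matrix.mul_assoc]
      rw [h, submatrix_apply, mul_diagonal, diagonal_mul, Pi.pow_apply, Pi.pow_apply,
        mul_right_comm, hpow, one_mul]
    simp only [hdiag]
    refine (Multiset.map_map (fun u => (A₂ᵀ * (A₁ * A₂ᵀ)⁻¹ * A₁) u u) σ.symm _).symm.trans ?_
    rw [Multiset.map_univ_val_equiv]
end

section
/- Let F_q be a finite field with q ≥ 4 elements, let α be a primitive element of F_q (a generator of F_q^⋆), and set ᾱ = (1, α, α², …, α^{q−2}) ∈ F_q^{q−1}. Let A ⊆ F_q^n be a linear code of dimension k with generator matrix 𝐀 ∈ F_q^{k×n}, and let ᾱ⊗A denote the closure, i.e., the row space of the Kronecker product ᾱ⊗𝐀 ∈ F_q^{k×n(q−1)}. Then ᾱ⊗A is self-orthogonal, ᾱ⊗A ⊆ (ᾱ⊗A)^⊥, and consequently the hull H(ᾱ⊗A) = (ᾱ⊗A) ∩ (ᾱ⊗A)^⊥ equals ᾱ⊗A and has dimension k. -/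
open Matrix

/-- The dual (orthogonal complement with respect to the standard bilinear form
`⟨x,y⟩ = ∑ i, x i * y i`) of a set of vectors. -/
def dualCode {F : Type*} [Field F] {ι : Type*} [Fintype ι] (C : Set (ι → F)) :
    Submodule F (ι → F) where
  carrier := {x | ∀ y ∈ C, ∑ i, x i * y i = 0}
  add_mem' := by
    intro a b ha hb y hy
    simp only [Pi.add_apply, add_mul, Finset.sum_add_distrib, ha y hy, hb y hy, add_zero]
  zero_mem' := by
    intro y hy
    simp
  smul_mem' := by
    intro c x hx y hy
    simp only [Pi.smul_apply, smul_eq_mul, mul_assoc, ← Finset.mul_sum, hx y hy, mul_zero]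

/-- The linear map `v ↦ w ⊗ v` into vectors indexed by pairs. -/
def kroneckerLeft {F κ ι : Type*} [Field F] (w : κ → F) : (ι → F) →ₗ[F] (κ × ι → F) where
  toFun v p := w p.1 * v p.2
  map_add' u v := by
    ext p
    simp [mul_add]
  map_smul' c v := by
    ext p
    simp [mul_left_comm]

theorem kroneckerLeft_injective {F κ ι : Type*} [Field F] {w : κ → F} {j : κ} (hj : w j ≠ 0) :
    Function.Injective (kroneckerLeft w : (ι → F) →ₗ[F] (κ × ι → F)) := by
  intro u v huv
  ext i
  exact mul_left_cancel₀ hj (congrFun huv (j, i))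

theorem span_range_kronecker {F κ ι μ : Type*} [Field F] (w : κ → F) (A : μ → ι → F) :
    Submodule.span F (Set.range (fun i : μ => fun p : κ × ι => w p.1 * A i p.2))
      = (Submodule.span F (Set.range A)).map (kroneckerLeft w) := by
  rw [Submodule.map_span, ← Set.range_comp]
  rfl

theorem map_kroneckerLeft_le_dualCode {F κ ι : Type*} [Field F] [Fintype κ] [Fintype ι]
    {w : κ → F} (hw : ∑ j, w j * w j = 0) (C : Submodule F (ι → F)) :
    C.map (kroneckerLeft w) ≤ dualCode (C.map (kroneckerLeft w) : Set (κ × ι → F)) := by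
  rintro _ ⟨u, -, rfl⟩ _ ⟨v, -, rfl⟩
  calc ∑ p : κ × ι, w p.1 * u p.2 * (w p.1 * v p.2)
      = (∑ j, w j * w j) * ∑ i, u i * v i := by
        rw [Fintype.sum_prod_type, Finset.sum_mul_sum]
        simp only [mul_mul_mul_comm]
    _ = 0 := by rw [hw, zero_mul]

/-- If `α` has order `m > 2`, the vector `(1, α, …, α ^ (m - 1))` is isotropic. -/
theorem sum_pow_mul_pow_eq_zero {F : Type*} [Field F] {α : F} {m : ℕ}
    (hα : orderOf α = m) (hm : 2 < m) :
    ∑ j : Fin m, α ^ (j : ℕ) * α ^ (j : ℕ) = 0 := by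
  have hne : α ^ 2 ≠ 1 := pow_ne_one_of_lt_orderOf two_ne_zero (hα ▸ hm)
  have hone : (α ^ 2) ^ m = 1 := by
    rw [← pow_mul, mul_comm, pow_mul, ← hα, pow_orderOf_eq_one, one_pow]
  simp only [← mul_pow, ← sq α]
  rw [Fin.sum_univ_eq_sum_range (fun j => (α ^ 2) ^ j), geom_sum_eq hne, hone, sub_self, zero_div]

/-- over a finite field `F_q` with `q ≥ 4`, with `α` a primitive element
and `ᾱ = (1, α, …, α^{q-2})`, the closure `ᾱ ⊗ A` (the row space of the Kronecker
product of `ᾱ` with a generator matrix `𝐀` of a `k`-dimensional code `A`) is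
self-orthogonal; hence its hull equals the whole closure and has dimension `k`. -/
theorem closure_self_orthogonal {F : Type*} [Field F] [Fintype F] {q k n : ℕ}
    (hq : Fintype.card F = q) (hq4 : 4 ≤ q)
    (α : F) (hα : orderOf α = q - 1)
    (A : Matrix (Fin k) (Fin n) F)
    (hA : Module.finrank F (Submodule.span F (Set.range A)) = k) :
    Submodule.span F
        (Set.range (fun i : Fin k => fun p : Fin (q - 1) × Fin n =>
          α ^ (p.1 : ℕ) * A i p.2))
      ≤ dualCode (Submodule.span F
          (Set.range (fun i : Fin k => fun p : Fin (q - 1) × Fin n =>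
            α ^ (p.1 : ℕ) * A i p.2)) : Set (Fin (q - 1) × Fin n → F)) ∧
    Submodule.span F
        (Set.range (fun i : Fin k => fun p : Fin (q - 1) × Fin n =>
          α ^ (p.1 : ℕ) * A i p.2))
      ⊓ dualCode (Submodule.span F
          (Set.range (fun i : Fin k => fun p : Fin (q - 1) × Fin n =>
            α ^ (p.1 : ℕ) * A i p.2)) : Set (Fin (q - 1) × Fin n → F))
      = Submodule.span F
        (Set.range (fun i : Fin k => fun p : Fin (q - 1) × Fin n =>
          α ^ (p.1 : ℕ) * A i p.2)) ∧
    Module.finrank F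
        ↥(Submodule.span F
          (Set.range (fun i : Fin k => fun p : Fin (q - 1) × Fin n =>
            α ^ (p.1 : ℕ) * A i p.2))
        ⊓ dualCode (Submodule.span F
            (Set.range (fun i : Fin k => fun p : Fin (q - 1) × Fin n =>
              α ^ (p.1 : ℕ) * A i p.2)) : Set (Fin (q - 1) × Fin n → F)))
      = k := by
  rw [span_range_kronecker (fun j : Fin (q - 1) => α ^ (j : ℕ)) A]
  have hle := map_kroneckerLeft_le_dualCode (sum_pow_mul_pow_eq_zero hα (by omega))
    (Submodule.span F (Set.range A))
  refine ⟨hle, inf_eq_left.mpr hle, ?_⟩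
  rw [inf_eq_left.mpr hle]
  have hinj : Function.Injective (kroneckerLeft (fun j : Fin (q - 1) => α ^ (j : ℕ)) :
      (Fin n → F) →ₗ[F] _) :=
    kroneckerLeft_injective (j := ⟨0, by omega⟩) (by simp)
  rw [← (Submodule.equivMapOfInjective _ hinj _).finrank_eq, hA]
end

section
/- Let F_q be a finite field, α a primitive element of F_q, ᾱ = (1, α, …, α^{q−2}) ∈ F_q^{q−1}, and let A ⊆ F_q^n be a linear code with generator matrix 𝐀. For every positive integer ℓ, the ℓ-th power code of the closure satisfies (ᾱ⊗A)^(ℓ) = ᾱ^{[ℓ]} ⊗ A^(ℓ), where ᾱ^{[ℓ]} = (1, α^ℓ, α^{2ℓ}, …, α^{(q−2)ℓ}) is the componentwise ℓ-th power of ᾱ, and ᾱ^{[ℓ]} ⊗ A^(ℓ) denotes the row space of the Kronecker product of ᾱ^{[ℓ]} with a generator matrix of A^(ℓ). -/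
open Matrix

/-- The `ℓ`-th power code of a linear code `C`: the span of all `ℓ`-fold
componentwise (Schur) products of codewords of `C`. -/
def powerCode {F : Type*} [Field F] {ι : Type*} (C : Submodule F (ι → F)) (ℓ : ℕ) :
    Submodule F (ι → F) :=
  Submodule.span F {v | ∃ x : Fin ℓ → ι → F, (∀ i, x i ∈ C) ∧ v = ∏ i, x i}

/-- The linear map `y ↦ (c^j * y_l)_{(j,l)}`, i.e. the Kronecker product of the row
vector `(1, c, c², …, c^{r-1})` with the row vector `y`. -/
def kronVec {F : Type*} [Field F] (r n : ℕ) (c : F) :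
    (Fin n → F) →ₗ[F] (Fin r × Fin n → F) where
  toFun y := fun p => c ^ (p.1 : ℕ) * y p.2
  map_add' y z := by
    funext p
    simp [mul_add]
  map_smul' a y := by
    funext p
    simp only [Pi.smul_apply, smul_eq_mul, RingHom.id_apply]
    ring

/-- A Schur product of Kronecker products with powers of `c` is the Kronecker product of the
Schur product with powers of `c ^ ℓ`. -/
theorem prod_kronVec {F : Type*} [Field F] (r n ℓ : ℕ) (c : F) (y : Fin ℓ → Fin n → F) :
    ∏ i, kronVec r n c (y i) = kronVec r n (c ^ ℓ) (∏ i, y i) := by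
  funext p
  simp [kronVec, Finset.prod_apply, Finset.prod_mul_distrib, pow_right_comm c]

/-- Taking powers of codes commutes with the Kronecker product by a vector of powers. -/
theorem powerCode_map_kronVec {F : Type*} [Field F] (r n ℓ : ℕ) (c : F)
    (C : Submodule F (Fin n → F)) :
    powerCode (C.map (kronVec r n c)) ℓ = (powerCode C ℓ).map (kronVec r n (c ^ ℓ)) := by
  rw [powerCode, powerCode, Submodule.map_span]
  congr 1
  ext v
  constructor
  · rintro ⟨x, hx, rfl⟩
    choose y hyC hy using hx
    refine ⟨∏ i, y i, ⟨y, hyC, rfl⟩, ?_⟩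
    rw [← prod_kronVec]
    exact Finset.prod_congr rfl fun i _ => hy i
  · rintro ⟨_, ⟨y, hy, rfl⟩, rfl⟩
    exact ⟨fun i => kronVec r n c (y i), fun i => Submodule.mem_map_of_mem (hy i),
      (prod_kronVec r n ℓ c y).symm⟩

/-- for a primitive element `α` of `F_q`, `ᾱ = (1,α,…,α^{q-2})` and a
code `A` with generator matrix `𝐀`, the `ℓ`-th power of the closure satisfies
`(ᾱ ⊗ A)^(ℓ) = ᾱ^{[ℓ]} ⊗ A^(ℓ)`, where `ᾱ^{[ℓ]} = (1, α^ℓ, …, α^{(q-2)ℓ})` is the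
componentwise `ℓ`-th power of `ᾱ`. -/
theorem power_of_closure {F : Type*} [Field F] [Fintype F] {q k n : ℕ}
    (hq : Fintype.card F = q)
    (α : F) (hα : orderOf α = q - 1)
    (A : Matrix (Fin k) (Fin n) F)
    (ℓ : ℕ) (hℓ : 0 < ℓ) :
    powerCode
        (Submodule.span F
          (Set.range (fun i : Fin k => fun p : Fin (q - 1) × Fin n =>
            α ^ (p.1 : ℕ) * A i p.2))) ℓ
      = Submodule.map (kronVec (q - 1) n (α ^ ℓ))
          (powerCode (Submodule.span F (Set.range A)) ℓ) := by
  rw [← powerCode_map_kronVec, Submodule.map_span]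
  exact congrArg (fun S => powerCode (Submodule.span F S) ℓ)
    (Set.range_comp (kronVec (q - 1) n α) (fun i => A i))
end

section
/- Let F_q be a finite field, α a primitive element, r a divisor of q−1, and ᾱ_r = (1, α^{(q−1)/r}, …, α^{(r−1)(q−1)/r}) ∈ F_q^r. Let A, B ∈ F_q^{k×n} with B = S·A·D·P for some S ∈ GL_k(F_q), diagonal matrix D with entries in F_q^⋆, and permutation matrix P. Then there exists a monomial matrix N ∈ F_q^{rn×rn} (a product of a permutation matrix and an invertible diagonal matrix) all of whose nonzero entries lie in the set of coset representatives {1, α, α², …, α^{(q−1)/r − 1}} of F_q^⋆ modulo the subgroup generated by α^{(q−1)/r}, such that ᾱ_r⊗B = S·(ᾱ_r⊗A)·N. -/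
open Matrix

/-- if `B = S·A·D·P` with `S` invertible, `D` diagonal with nonzero
entries and `P` a permutation matrix, then for the `r`-th partial closure
(`r ∣ q-1`, `ᾱ_r = (1, α^{(q-1)/r}, …, α^{(r-1)(q-1)/r})`) there is a monomial matrix
`N` (a product of an invertible diagonal matrix and a permutation matrix) all of
whose nonzero entries lie in the coset representatives `{1, α, …, α^{(q-1)/r - 1}}`
of `F_q^⋆` modulo `⟨α^{(q-1)/r}⟩`, such that `ᾱ_r ⊗ B = S · (ᾱ_r ⊗ A) · N`. -/
theorem partial_closure_monomial {F : Type*} [Field F] [Fintype F]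
    {q r k n : ℕ} (hq : Fintype.card F = q)
    (α : F) (hα : orderOf α = q - 1)
    (hr : r ∣ (q - 1)) (hr0 : 0 < r)
    (A B : Matrix (Fin k) (Fin n) F)
    (S : GL (Fin k) F)
    (d : Fin n → F) (hd : ∀ u, d u ≠ 0)
    (σ : Equiv.Perm (Fin n))
    (hB : B = (S : Matrix (Fin k) (Fin k) F) * A * Matrix.diagonal d * σ.permMatrix F) :
    ∃ N : Matrix (Fin r × Fin n) (Fin r × Fin n) F,
      (∃ (τ : Equiv.Perm (Fin r × Fin n)) (e : Fin r × Fin n → F),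
        (∀ p, e p ≠ 0) ∧ N = Matrix.diagonal e * τ.permMatrix F) ∧
      (∀ p₁ p₂, N p₁ p₂ ≠ 0 → ∃ t, t < (q - 1) / r ∧ N p₁ p₂ = α ^ t) ∧
      (Matrix.of fun (i : Fin k) (p : Fin r × Fin n) =>
          α ^ ((p.1 : ℕ) * ((q - 1) / r)) * B i p.2)
        = (S : Matrix (Fin k) (Fin k) F) *
          (Matrix.of fun (i : Fin k) (p : Fin r × Fin n) =>
            α ^ ((p.1 : ℕ) * ((q - 1) / r)) * A i p.2) * N := by
  subst hq
  have hq1 : 0 < Fintype.card F - 1 := Nat.sub_pos_of_lt Fintype.one_lt_card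
  have : NeZero (Fintype.card F - 1) := ⟨hq1.ne'⟩
  have : NeZero r := ⟨hr0.ne'⟩
  obtain ⟨m, hm⟩ := hr
  have hdiv : (Fintype.card F - 1) / r = m := by rw [hm, Nat.mul_div_cancel_left _ hr0]
  have hm0 : 0 < m := Nat.pos_of_mul_pos_left (hm ▸ hq1)
  rw [hdiv]
  have hprim : IsPrimitiveRoot α (Fintype.card F - 1) := hα ▸ IsPrimitiveRoot.orderOf α
  have hα0 : α ≠ 0 := hprim.ne_zero hq1.ne'
  have hαm : (α ^ m) ^ r = 1 := by rw [← pow_mul, mul_comm, ← hm, hprim.pow_eq_one]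
  have hlog (u : Fin n) : ∃ x < Fintype.card F - 1, α ^ x = d u :=
    hprim.eq_pow_of_pow_eq_one (FiniteField.pow_card_sub_one_eq_one _ (hd u))
  choose x hx hxd using hlog
  let t (u : Fin n) : Fin r := ⟨x u / m, Nat.div_lt_of_lt_mul (by rw [mul_comm, ← hm]; exact hx u)⟩
  let τ : Equiv.Perm (Fin r × Fin n) :=
    { toFun := fun p => (p.1 - t p.2, σ p.2)
      invFun := fun p => (p.1 + t (σ.symm p.2), σ.symm p.2)
      left_inv := fun p => by simp
      right_inv := fun p => by simp }
  let e (p : Fin r × Fin n) : F := α ^ (x p.2 % m)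
  refine ⟨diagonal e * τ.permMatrix F, ⟨τ, e, fun p => pow_ne_zero _ hα0, rfl⟩, ?_, ?_⟩
  · intro p₁ p₂ h
    refine ⟨x p₁.2 % m, Nat.mod_lt _ hm0, ?_⟩
    rw [diagonal_mul, Equiv.Perm.permMatrix, PEquiv.toMatrix_apply] at h ⊢
    split_ifs at h ⊢
    · exact mul_one _
    · simp at h
  · ext i ⟨j, v⟩
    have hτ : τ.symm (j, v) = (j + t (σ.symm v), σ.symm v) := rfl
    have hpow : (α ^ m) ^ ((j + t (σ.symm v) : Fin r) : ℕ) =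
        (α ^ m) ^ ((j : ℕ) + x (σ.symm v) / m) := by
      rw [Fin.val_add, ← pow_eq_pow_mod _ hαm]
    rw [hB, ← Matrix.mul_assoc]
    simp only [of_apply, Equiv.Perm.permMatrix, PEquiv.mul_toMatrix_toPEquiv, submatrix_apply,
      id, mul_diagonal, hτ, e]
    simp only [mul_apply, of_apply, Finset.mul_sum, Finset.sum_mul]
    refine Finset.sum_congr rfl fun l _ => ?_
    have hsplit : d (σ.symm v) = (α ^ m) ^ (x (σ.symm v) / m) * α ^ (x (σ.symm v) % m) := by
      rw [← hxd, ← pow_mul, ← pow_add, Nat.div_add_mod]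
    rw [mul_comm (j : ℕ) m, mul_comm _ m, pow_mul, pow_mul, hpow, pow_add, hsplit]
    ring
end

section
/- Let F_q be a finite field, α a primitive element, r a divisor of q−1 with r > 2, and ᾱ_r = (1, α^{(q−1)/r}, …, α^{(r−1)(q−1)/r}) ∈ F_q^r. Let U be the subgroup of F_q^⋆ generated by α^{(q−1)/r}. Let A, B ⊆ F_q^n be linear codes of dimension k with generator matrices 𝐀, 𝐁 ∈ F_q^{k×n}. Then there exist S ∈ GL_k(F_q), a diagonal matrix D with all diagonal entries in U, and a permutation matrix P such that 𝐁 = S·𝐀·D·P, if and only if there exist S' ∈ GL_k(F_q) and a permutation matrix Q ∈ F_q^{rn×rn} such that ᾱ_r⊗𝐁 = S'·(ᾱ_r⊗𝐀)·Q. (Reduction of LEP(U) to PEP via the partial closure.) -/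
open Matrix

/-- Two functions on a finite type with equinumerous fibres differ by a permutation. -/
theorem exists_perm_comp_eq_of_card_fiber_eq {ι X : Type*} [Finite ι] (f g : ι → X)
    (h : ∀ x, Nat.card {i // f i = x} = Nat.card {i // g i = x}) :
    ∃ σ : Equiv.Perm ι, ∀ i, f (σ i) = g i := by
  have e : ∀ x, {i // g i = x} ≃ {i // f i = x} := fun x =>
    (Finite.card_eq.mp (h x).symm).some
  refine ⟨((Equiv.sigmaFiberEquiv g).symm.trans (Equiv.sigmaCongrRight e)).trans
    (Equiv.sigmaFiberEquiv f), fun i => ?_⟩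
  exact (e (g i) ⟨i, rfl⟩).2

/-- A permutation of `κ × ι` matching `f` and `g` through the second projection
yields a permutation of `ι` matching them. -/
theorem exists_perm_comp_eq_of_perm_prod {κ ι X : Type*} [Finite κ] [Nonempty κ] [Finite ι]
    (f g : ι → X) (τ : Equiv.Perm (κ × ι)) (h : ∀ p, f (τ p).2 = g p.2) :
    ∃ σ : Equiv.Perm ι, ∀ i, f (σ i) = g i := by
  have card_fiber (φ : ι → X) (x : X) :
      Nat.card {p : κ × ι // φ p.2 = x} = Nat.card κ * Nat.card {i // φ i = x} := by
    rw [← Nat.card_prod]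
    exact Nat.card_congr
      { toFun := fun p => (p.1.1, ⟨p.1.2, p.2⟩)
        invFun := fun p => ⟨(p.1, p.2.1), p.2.2⟩
        left_inv := fun _ => rfl
        right_inv := fun _ => rfl }
  refine exists_perm_comp_eq_of_card_fiber_eq f g fun x => ?_
  refine Nat.eq_of_mul_eq_mul_left (Nat.card_pos (α := κ)) ?_
  rw [← card_fiber, ← card_fiber]
  exact (Nat.card_congr (τ.subtypeEquiv fun p => by rw [h])).symm

/-- Vectors are related when they differ by a power of a fixed root of unity. -/
def powSMulSetoid {R M : Type*} [Monoid R] [MulAction R M] (b : R) {r : ℕ} (hr : 0 < r)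
    (hb : b ^ r = 1) : Setoid M where
  r v w := ∃ m : ℕ, w = b ^ m • v
  iseqv :=
    { refl := fun v => ⟨0, by simp⟩
      symm := by
        rintro v w ⟨m, rfl⟩
        refine ⟨(r - 1) * m, ?_⟩
        rw [smul_smul, ← pow_add, ← Nat.succ_mul, Nat.succ_eq_add_one, Nat.sub_add_cancel hr,
          pow_mul, hb, one_pow, one_smul]
      trans := by
        rintro u v w ⟨m, rfl⟩ ⟨l, rfl⟩
        exact ⟨l + m, by rw [smul_smul, pow_add]⟩ }

/-- Shifting the first coordinate in a way depending on the second one, which is permuted. -/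
def shiftPerm {κ ι : Type*} [AddGroup κ] (c : ι → κ) (σ : Equiv.Perm ι) :
    Equiv.Perm (κ × ι) where
  toFun p := (p.1 + c p.2, σ p.2)
  invFun p := (p.1 - c (σ.symm p.2), σ.symm p.2)
  left_inv p := by simp
  right_inv p := by simp

theorem mul_permMatrix_apply {m n R : Type*} [Fintype n] [DecidableEq n] [NonAssocSemiring R]
    (M : Matrix m n R) (σ : Equiv.Perm n) (i : m) (j : n) :
    (M * σ.permMatrix R) i j = M i (σ.symm j) := by
  rw [Equiv.Perm.permMatrix, PEquiv.mul_toMatrix_toPEquiv]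
  rfl

theorem mul_of_mul_apply {l m n κ R : Type*} [Fintype m] [CommSemiring R]
    (S : Matrix l m R) (A : Matrix m n R) (c : κ → R) (i : l) (p : κ × n) :
    (S * Matrix.of fun (i : m) (p : κ × n) => c p.1 * A i p.2) i p = c p.1 * (S * A) i p.2 := by
  simp only [Matrix.mul_apply, Matrix.of_apply, Finset.mul_sum]
  exact Finset.sum_congr rfl fun _ _ => mul_left_comm _ _ _

/-- reduction of LEP(U) to PEP via the partial closure: let `α` be a
primitive element of `F_q`, `r ∣ q-1` with `r > 2`, `U = ⟨α^{(q-1)/r}⟩ ⊆ F_q^⋆`, and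
`ᾱ_r = (1, α^{(q-1)/r}, …, α^{(r-1)(q-1)/r})`.  For codes of dimension `k` with
generator matrices `𝐀, 𝐁`, there exist `S ∈ GL_k(F_q)`, a diagonal matrix `D` with
entries in `U`, and a permutation matrix `P` with `𝐁 = S·𝐀·D·P`, if and only if the
partial closures `ᾱ_r ⊗ 𝐀` and `ᾱ_r ⊗ 𝐁` are permutation equivalent. -/
theorem partial_closure_reduction {F : Type*} [Field F] [Fintype F]
    {q r k n : ℕ} (hq : Fintype.card F = q)
    (α : F) (hα : orderOf α = q - 1)
    (hr : r ∣ (q - 1)) (hr2 : 2 < r)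
    (A B : Matrix (Fin k) (Fin n) F)
    (hA : Module.finrank F (Submodule.span F (Set.range A)) = k)
    (hB : Module.finrank F (Submodule.span F (Set.range B)) = k) :
    (∃ (S : GL (Fin k) F) (d : Fin n → F) (σ : Equiv.Perm (Fin n)),
        (∀ u, ∃ m : ℕ, d u = α ^ (((q - 1) / r) * m)) ∧
        B = (S : Matrix (Fin k) (Fin k) F) * A * Matrix.diagonal d * σ.permMatrix F)
    ↔ (∃ (S' : GL (Fin k) F) (τ : Equiv.Perm (Fin r × Fin n)),
        (Matrix.of fun (i : Fin k) (p : Fin r × Fin n) =>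
            α ^ ((p.1 : ℕ) * ((q - 1) / r)) * B i p.2)
          = (S' : Matrix (Fin k) (Fin k) F) *
            (Matrix.of fun (i : Fin k) (p : Fin r × Fin n) =>
              α ^ ((p.1 : ℕ) * ((q - 1) / r)) * A i p.2) * τ.permMatrix F) := by
  set b := α ^ ((q - 1) / r) with hb
  have hbr : b ^ r = 1 := by
    rw [hb, ← pow_mul, Nat.div_mul_cancel hr, ← hα, pow_orderOf_eq_one]
  have hpow (l : ℕ) : α ^ (l * ((q - 1) / r)) = b ^ l := by rw [hb, ← pow_mul, mul_comm]
  have hr0 : 0 < r := by lia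
  have : NeZero r := ⟨hr0.ne'⟩
  simp only [hpow, pow_mul]
  simp only [← hb]
  constructor
  · rintro ⟨S, d, σ, hd, hBA⟩
    choose m hm using hd
    refine ⟨S, (shiftPerm (fun j => Fin.ofNat r (m (σ.symm j))) σ.symm).symm, ?_⟩
    ext i p
    rw [mul_permMatrix_apply, mul_of_mul_apply _ _ (fun l : Fin r => b ^ (l : ℕ)), hBA,
      Matrix.of_apply, mul_permMatrix_apply, Matrix.mul_diagonal, hm]
    change _ = b ^ ((p.1 + Fin.ofNat r (m (σ.symm p.2)) : Fin r) : ℕ) * _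
    have hmod : b ^ ((p.1 + Fin.ofNat r (m (σ.symm p.2)) : Fin r) : ℕ)
        = b ^ (p.1 : ℕ) * b ^ m (σ.symm p.2) := by
      rw [Fin.val_add, ← pow_eq_pow_mod _ hbr, pow_add, Fin.val_ofNat, ← pow_eq_pow_mod _ hbr]
    rw [hmod]
    change _ = _ * _ * (S.val * A) i (σ.symm p.2)
    ring
  · rintro ⟨S, τ, h⟩
    let s : Setoid (Fin k → F) := powSMulSetoid b hr0 hbr
    have hsmul (l : ℕ) (v : Fin k → F) :
        (Quotient.mk s (b ^ l • v)) = Quotient.mk s v :=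
      (Quotient.sound (s := s) (show ∃ m : ℕ, _ = b ^ m • v from ⟨l, rfl⟩)).symm
    obtain ⟨σ, hσ⟩ := exists_perm_comp_eq_of_perm_prod
      (fun u => Quotient.mk s ((S.val * A).col u)) (fun u => Quotient.mk s (B.col u)) τ.symm
      fun p => by
        rw [← hsmul ((τ.symm p).1 : ℕ), ← hsmul (p.1 : ℕ) (B.col p.2)]
        congr 1
        ext i
        have := congrFun (congrFun h i) p
        rw [mul_permMatrix_apply, mul_of_mul_apply _ _ (fun l : Fin r => b ^ (l : ℕ))] at this
        exact this.symm
    choose m hm using fun j => Quotient.exact (hσ j)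
    refine ⟨S, fun u => b ^ m (σ.symm u), σ.symm, fun u => ⟨_, rfl⟩, ?_⟩
    ext i j
    rw [mul_permMatrix_apply, Matrix.mul_diagonal, Equiv.symm_symm, Equiv.symm_apply_apply,
      mul_comm]
    exact congrFun (hm j) i
end

section
/- Let F_q be a finite field with q ≥ 3 elements, α a primitive element of F_q, and ᾱ = (1, α, …, α^{q−2}) ∈ F_q^{q−1}. Let A, B ⊆ F_q^n be linear codes of dimension k with generator matrices 𝐀, 𝐁 ∈ F_q^{k×n}. Then A and B are linearly equivalent — i.e., there exist S ∈ GL_k(F_q), a diagonal matrix D with all diagonal entries in F_q^⋆, and a permutation matrix P with 𝐁 = S·𝐀·D·P — if and only if the closures are permutation equivalent, i.e., there exist S' ∈ GL_k(F_q) and a permutation matrix Q ∈ F_q^{n(q−1)×n(q−1)} such that ᾱ⊗𝐁 = S'·(ᾱ⊗𝐀)·Q. -/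
open Matrix

/-- Two families indexed by `ι` whose values, each repeated `κ` times, agree up to a permutation
already agree up to a permutation of `ι`. -/
theorem exists_perm_of_perm_prod {κ ι γ : Type*} [Finite κ] [Nonempty κ] [Finite ι]
    (f g : ι → γ) (τ : Equiv.Perm (κ × ι)) (h : ∀ p, g p.2 = f (τ p).2) :
    ∃ σ : Equiv.Perm ι, ∀ j, g j = f (σ j) := by
  have fiber (f : ι → γ) (c : γ) :
      Nat.card {p : κ × ι // f p.2 = c} = Nat.card κ * Nat.card {j // f j = c} := by
    rw [← Nat.card_prod]
    exact Nat.card_congr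
      { toFun := fun p => (p.1.1, ⟨p.1.2, p.2⟩)
        invFun := fun p => ⟨(p.1, p.2.1), p.2.2⟩
        left_inv := fun _ => rfl
        right_inv := fun _ => rfl }
  have card_eq (c : γ) : Nat.card {j // g j = c} = Nat.card {j // f j = c} := by
    refine Nat.eq_of_mul_eq_mul_left (Nat.card_pos (α := κ)) ?_
    rw [← fiber g, ← fiber f]
    exact Nat.card_congr (τ.subtypeEquiv fun p => by rw [h p])
  refine ⟨Equiv.ofFiberEquiv fun c => (Finite.card_eq.mp (card_eq c)).some, fun j => ?_⟩
  exact (Equiv.ofFiberEquiv_map _ j).symm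

/-- The powers `α ^ i`, `i < q - 1`, of a primitive element enumerate the nonzero elements. -/
theorem exists_equiv_units_of_orderOf {F : Type*} [Field F] [Fintype F] {q : ℕ}
    (hq : Fintype.card F = q) (α : F) (hα : orderOf α = q - 1) :
    ∃ e : Fin (q - 1) ≃ Fˣ, ∀ i, (e i : F) = α ^ (i : ℕ) := by
  classical
  have hq1 : 0 < q - 1 := by
    have := Fintype.one_lt_card (α := F)
    omega
  have h0 : α ≠ 0 := by
    rintro rfl
    have h := pow_orderOf_eq_one (0 : F)
    rw [hα, zero_pow hq1.ne'] at h
    exact zero_ne_one h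
  have hbij : Function.Bijective fun i : Fin (q - 1) => Units.mk0 α h0 ^ (i : ℕ) := by
    rw [Fintype.bijective_iff_injective_and_card]
    refine ⟨fun i j hij => Fin.ext ?_, by simp [Fintype.card_units, hq]⟩
    refine pow_injOn_Iio_orderOf (x := α) (by simp [hα]) (by simp [hα]) ?_
    simpa using congrArg Units.val hij
  exact ⟨Equiv.ofBijective _ hbij, fun i => by simp⟩


/-- reduction of LEP to PEP via the closure, `q ≥ 3`: let `α` be a
primitive element of `F_q` and `ᾱ = (1, α, …, α^{q-2})`.  Codes of dimension `k` with
generator matrices `𝐀, 𝐁` are linearly equivalent (i.e. `𝐁 = S·𝐀·D·P` for some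
invertible `S`, diagonal `D` with nonzero entries, permutation matrix `P`) if and
only if their closures `ᾱ ⊗ 𝐀` and `ᾱ ⊗ 𝐁` are permutation equivalent. -/
theorem closure_reduction_LEP_to_PEP {F : Type*} [Field F] [Fintype F]
    {q k n : ℕ} (hq : Fintype.card F = q) (hq3 : 3 ≤ q)
    (α : F) (hα : orderOf α = q - 1)
    (A B : Matrix (Fin k) (Fin n) F)
    (hA : Module.finrank F (Submodule.span F (Set.range A)) = k)
    (hB : Module.finrank F (Submodule.span F (Set.range B)) = k) :
    (∃ (S : GL (Fin k) F) (d : Fin n → F) (σ : Equiv.Perm (Fin n)),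
        (∀ u, d u ≠ 0) ∧
        B = (S : Matrix (Fin k) (Fin k) F) * A * Matrix.diagonal d * σ.permMatrix F)
    ↔ (∃ (S' : GL (Fin k) F) (τ : Equiv.Perm (Fin (q - 1) × Fin n)),
        (Matrix.of fun (i : Fin k) (p : Fin (q - 1) × Fin n) =>
            α ^ (p.1 : ℕ) * B i p.2)
          = (S' : Matrix (Fin k) (Fin k) F) *
            (Matrix.of fun (i : Fin k) (p : Fin (q - 1) × Fin n) =>
              α ^ (p.1 : ℕ) * A i p.2) * τ.permMatrix F) := by
  obtain ⟨e, he⟩ := exists_equiv_units_of_orderOf hq α hα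
  have : NeZero (q - 1) := ⟨by omega⟩
  constructor
  · rintro ⟨S, d, σ, hd, hBA⟩
    have hcol (i j) : B i j = ((S : Matrix (Fin k) (Fin k) F) * A) i (σ.symm j) * d (σ.symm j) := by
      rw [hBA, Equiv.Perm.permMatrix, PEquiv.mul_toMatrix_toPEquiv, submatrix_apply,
        mul_diagonal, id]
    let c (j : Fin n) : Fˣ := Units.mk0 (d j) (hd j)
    let τ : Equiv.Perm (Fin (q - 1) × Fin n) :=
      { toFun := fun p => (e.symm (e p.1 * (c p.2)⁻¹), σ p.2)
        invFun := fun p => (e.symm (e p.1 * c (σ.symm p.2)), σ.symm p.2)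
        left_inv := fun p => by simp
        right_inv := fun p => by simp }
    refine ⟨S, τ, ?_⟩
    ext i p
    have hpow : α ^ ((τ.symm p).1 : ℕ) = α ^ (p.1 : ℕ) * d (σ.symm p.2) := by
      rw [← he, ← he]
      simp [τ, c]
    rw [Equiv.Perm.permMatrix, PEquiv.mul_toMatrix_toPEquiv, submatrix_apply, id, of_apply,
      hcol, mul_apply, mul_apply]
    simp only [of_apply, hpow, Finset.sum_mul, Finset.mul_sum]
    refine Finset.sum_congr rfl fun l _ => ?_
    change _ = _ * (_ * A l (σ.symm p.2))
    ring
  · rintro ⟨S, τ, hBA⟩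
    let M := (S : Matrix (Fin k) (Fin k) F) * A
    have hcol (p : Fin (q - 1) × Fin n) : e p.1 • B.col p.2 =
        e (τ.symm p).1 • M.col (τ.symm p).2 := by
      ext i
      have h := congrFun (congrFun hBA i) p
      rw [Equiv.Perm.permMatrix, PEquiv.mul_toMatrix_toPEquiv, submatrix_apply, id, of_apply,
        mul_apply] at h
      simp only [of_apply] at h
      simp only [Pi.smul_apply, Units.smul_def, smul_eq_mul, he, col_apply, M, mul_apply,
        Finset.mul_sum, h]
      exact Finset.sum_congr rfl fun l _ => by ring
    let orbit (v : Fin k → F) : MulAction.orbitRel.Quotient Fˣ (Fin k → F) := ⟦v⟧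
    have orbit_smul (c : Fˣ) (v) : orbit (c • v) = orbit v :=
      Quotient.sound (MulAction.mem_orbit v c)
    obtain ⟨σ, hσ⟩ := exists_perm_of_perm_prod (fun j => orbit (M.col j))
      (fun j => orbit (B.col j)) τ.symm fun p => by
        have h := congrArg orbit (hcol p)
        rwa [orbit_smul, orbit_smul] at h
    have hc (j) : ∃ c : Fˣ, c • M.col (σ j) = B.col j := Quotient.exact (hσ j)
    choose c hc using hc
    refine ⟨S, fun j => c (σ.symm j), σ.symm, fun j => (c _).ne_zero, ?_⟩
    ext i j
    rw [Equiv.Perm.permMatrix, PEquiv.mul_toMatrix_toPEquiv, submatrix_apply, mul_diagonal, id]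
    have h := congrFun (hc j) i
    simp only [Pi.smul_apply, Units.smul_def, smul_eq_mul, col_apply] at h
    simp [← h, M, mul_comm]
end
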